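/- For every natural number k there exist nonnegative integers x, y, z with x + y + z = k + 1, |3x − k| ≤ 3, |3y − k| ≤ 3 and |3z − k| ≤ 3, such that the pattern cut S(x,y,z,0) is a maximum cut of CC_k. -/

import Mathlib

/-- The cut size of a cut `S` of a finite simple graph `G`: the number of edges of `G` with
exactly one endpoint in `S` (counted as ordered pairs whose first component is in `S`). -/
def cutSize {V : Type*} [Fintype V] [DecidableEq V] (G : SimpleGraph V) [DecidableRel G.Adj]
    (S : Finset V) : ℕ :=
  ((Finset.univ : Finset (V × V)).filter fun p => G.Adj p.1 p.2 ∧ p.1 ∈ S ∧ p.2 ∉ S).card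

/-- The maximum cut size of a finite simple graph `G`. -/
def maxCut {V : Type*} [Fintype V] [DecidableEq V] (G : SimpleGraph V) [DecidableRel G.Adj] : ℕ :=
  Finset.univ.powerset.sup fun S => cutSize G S

def ccRel (k : ℕ) : (Fin (k+1) ⊕ Fin (k+1)) → (Fin (k+1) ⊕ Fin (k+1)) → Prop
  | Sum.inl _, Sum.inl _ => True
  | Sum.inr _, Sum.inr _ => True
  | Sum.inl i, Sum.inr j => (j : ℕ) < (i : ℕ)
  | Sum.inr _, Sum.inl _ => False

instance (k : ℕ) : DecidableRel (ccRel k) := fun u v =>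
  match u, v with
  | Sum.inl _, Sum.inl _ => inferInstanceAs (Decidable True)
  | Sum.inr _, Sum.inr _ => inferInstanceAs (Decidable True)
  | Sum.inl i, Sum.inr j => inferInstanceAs (Decidable ((j : ℕ) < (i : ℕ)))
  | Sum.inr _, Sum.inl _ => inferInstanceAs (Decidable False)

/-- The graph `CC_k`: vertices `v_0,…,v_k` (encoded `Sum.inl i`) and `v'_0,…,v'_k`
(encoded `Sum.inr j`); each side is a clique and `v_i ~ v'_j` iff `j < i`. -/
def CCk (k : ℕ) : SimpleGraph (Fin (k+1) ⊕ Fin (k+1)) := SimpleGraph.fromRel (ccRel k)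

instance (k : ℕ) : DecidableRel (CCk k).Adj := fun u v =>
  inferInstanceAs (Decidable (u ≠ v ∧ (ccRel k u v ∨ ccRel k v u)))

/-- The pattern cut `S(x,y,z,t)` of `CC_k` (for `x+y+z+t = k+1`): `v_i ∈ S` iff
`i < x` or `i ≥ x+y+z`, and `v'_j ∈ S` iff `j < x+y`. -/
def patternCut (k x y z t : ℕ) : Finset (Fin (k+1) ⊕ Fin (k+1)) :=
  ((Finset.univ.filter fun i : Fin (k+1) => (i : ℕ) < x ∨ x + y + z ≤ (i : ℕ)).image Sum.inl) ∪
  ((Finset.univ.filter fun j : Fin (k+1) => (j : ℕ) < x + y).image Sum.inr)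

theorem sum_range_ite_lt {n i : ℕ} (hi : i ≤ n) (f : ℕ → ℤ) :
    ∑ j ∈ Finset.range n, (if j < i then f j else 0) = ∑ j ∈ Finset.range i, f j := by
  rw [← Finset.sum_filter]
  congr 1
  ext j
  simp only [Finset.mem_filter, Finset.mem_range]
  omega

theorem two_mul_sum_range_cast (n : ℕ) :
    2 * ∑ i ∈ Finset.range n, (i : ℤ) = n * (n - 1) := by
  induction n with
  | zero => simp
  | succ n ih => rw [Finset.sum_range_succ, mul_add, ih]; push_cast; ring

/-- The cut size of `S` in `CC_k` in terms of the `±1` indicators `a`, `b` of `S` on the two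
cliques. -/
theorem four_mul_cutSize_CCk (k : ℕ) (S : Finset (Fin (k + 1) ⊕ Fin (k + 1))) (a b : ℕ → ℤ)
    (ha : ∀ i : Fin (k + 1), a i = if Sum.inl i ∈ S then 1 else -1)
    (hb : ∀ i : Fin (k + 1), b i = if Sum.inr i ∈ S then 1 else -1) :
    4 * (cutSize (CCk k) S : ℤ) = 3 * (k + 1) ^ 2 - (k + 1)
      - (∑ i ∈ Finset.range (k + 1), a i) ^ 2 - (∑ i ∈ Finset.range (k + 1), b i) ^ 2
      - 2 * ∑ i ∈ Finset.range (k + 1), a i * ∑ j ∈ Finset.range i, b j := by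
  have clique : ∀ c : ℕ → ℤ, ∑ i : Fin (k + 1), ∑ j : Fin (k + 1), (1 + c i) * (1 - c j)
      = (k + 1) ^ 2 - (∑ i ∈ Finset.range (k + 1), c i) ^ 2 := by
    intro c
    rw [← Finset.sum_mul_sum, Fin.sum_univ_eq_sum_range (fun i => 1 + c i),
      Fin.sum_univ_eq_sum_range (fun i => 1 - c i), Finset.sum_add_distrib,
      Finset.sum_sub_distrib]
    simp only [Finset.sum_const, Finset.card_range, nsmul_eq_mul, mul_one]
    push_cast
    ring
  have cross : ∑ i : Fin (k + 1), ∑ j : Fin (k + 1),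
      (if (j : ℕ) < i then 2 - 2 * (a i * b j) else 0)
      = (k + 1) * k - 2 * ∑ i ∈ Finset.range (k + 1), a i * ∑ j ∈ Finset.range i, b j := by
    have inner : ∀ i : Fin (k + 1), ∑ j : Fin (k + 1),
        (if (j : ℕ) < i then 2 - 2 * (a i * b j) else 0)
        = 2 * (i : ℕ) - 2 * (a i * ∑ j ∈ Finset.range i, b j) := by
      intro i
      rw [Fin.sum_univ_eq_sum_range (fun j => if j < (i : ℕ) then 2 - 2 * (a i * b j) else 0),
        sum_range_ite_lt i.isLt.le (fun j => 2 - 2 * (a i * b j)), Finset.sum_sub_distrib,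
        ← Finset.mul_sum, ← Finset.mul_sum]
      simp only [Finset.sum_const, Finset.card_range, nsmul_eq_mul]
      ring
    rw [Finset.sum_congr rfl fun i _ => inner i,
      Fin.sum_univ_eq_sum_range
        (fun i => 2 * (i : ℤ) - 2 * (a i * ∑ j ∈ Finset.range i, b j)),
      Finset.sum_sub_distrib, ← Finset.mul_sum, ← Finset.mul_sum, two_mul_sum_range_cast]
    push_cast
    ring
  have expand : 4 * (cutSize (CCk k) S : ℤ) =
      ∑ i : Fin (k + 1), ∑ j : Fin (k + 1), (1 + a i) * (1 - a j)
      + ∑ i : Fin (k + 1), ∑ j : Fin (k + 1), (1 + b i) * (1 - b j)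
      + ∑ i : Fin (k + 1), ∑ j : Fin (k + 1),
        (if (j : ℕ) < i then 2 - 2 * (a i * b j) else 0) := by
    have split : ∑ i : Fin (k + 1), ∑ j : Fin (k + 1),
        (if (j : ℕ) < i then 2 - 2 * (a i * b j) else 0)
        = ∑ i : Fin (k + 1), ∑ j : Fin (k + 1),
          (if (j : ℕ) < i then (1 + a i) * (1 - b j) else 0)
        + ∑ j : Fin (k + 1), ∑ i : Fin (k + 1),
          (if (j : ℕ) < i then (1 + b j) * (1 - a i) else 0) := by
      rw [Finset.sum_comm (γ := Fin (k + 1)) (f := fun j i : Fin (k + 1) =>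
        if (j : ℕ) < i then (1 + b j) * (1 - a i) else 0)]
      simp only [← Finset.sum_add_distrib]
      refine Finset.sum_congr rfl fun i _ => Finset.sum_congr rfl fun j _ => ?_
      split_ifs <;> ring
    rw [split, cutSize, Finset.card_filter, Fintype.sum_prod_type, Fintype.sum_sum_type]
    simp only [Fintype.sum_sum_type, Finset.sum_add_distrib]
    push_cast
    simp only [mul_add, Finset.mul_sum]
    have ll : ∀ i j : Fin (k + 1), (4 * (if (CCk k).Adj (Sum.inl i) (Sum.inl j) ∧ Sum.inl i ∈ S ∧
        Sum.inl j ∉ S then 1 else 0) : ℤ) = (1 + a i) * (1 - a j) := by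
      intro i j
      rw [ha, ha]
      by_cases hij : i = j
      · subst hij; by_cases h : Sum.inl i ∈ S <;> simp [h]
      · by_cases h : Sum.inl i ∈ S <;> by_cases h' : Sum.inl j ∈ S <;>
          simp [h, h', CCk, ccRel, hij]
    have rr : ∀ i j : Fin (k + 1), (4 * (if (CCk k).Adj (Sum.inr i) (Sum.inr j) ∧ Sum.inr i ∈ S ∧
        Sum.inr j ∉ S then 1 else 0) : ℤ) = (1 + b i) * (1 - b j) := by
      intro i j
      rw [hb, hb]
      by_cases hij : i = j
      · subst hij; by_cases h : Sum.inr i ∈ S <;> simp [h]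
      · by_cases h : Sum.inr i ∈ S <;> by_cases h' : Sum.inr j ∈ S <;>
          simp [h, h', CCk, ccRel, hij]
    have lr : ∀ i j : Fin (k + 1), (4 * (if (CCk k).Adj (Sum.inl i) (Sum.inr j) ∧ Sum.inl i ∈ S ∧
        Sum.inr j ∉ S then 1 else 0) : ℤ)
        = if (j : ℕ) < i then (1 + a i) * (1 - b j) else 0 := by
      intro i j
      rw [ha, hb]
      by_cases h : Sum.inl i ∈ S <;> by_cases h' : Sum.inr j ∈ S <;>
        simp [h, h', CCk, ccRel]
    have rl : ∀ j i : Fin (k + 1), (4 * (if (CCk k).Adj (Sum.inr j) (Sum.inl i) ∧ Sum.inr j ∈ S ∧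
        Sum.inl i ∉ S then 1 else 0) : ℤ)
        = if (j : ℕ) < i then (1 + b j) * (1 - a i) else 0 := by
      intro j i
      rw [ha, hb]
      by_cases h : Sum.inl i ∈ S <;> by_cases h' : Sum.inr j ∈ S <;>
        simp [h, h', CCk, ccRel]
    simp only [ll, rr, lr, rl]
    ring
  rw [expand, clique a, clique b, cross]
  ring

/-- A discrete isoperimetric inequality: the `±1` sequences `a`, `b` trace a lattice path which in
the coordinates `u = (∑ a + ∑ b) / 2`, `w = (∑ a - ∑ b) / 2` makes `p` horizontal and `q` vertical
unit steps, and the area it sweeps is bounded in terms of `p`, `q` and its endpoint. -/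
theorem exists_lattice_path_area_bound (a b : ℕ → ℤ) (ha : ∀ i, a i = 1 ∨ a i = -1)
    (hb : ∀ i, b i = 1 ∨ b i = -1) (n : ℕ) :
    ∃ p q u w : ℤ, p + q = n ∧ |u| ≤ p ∧ |w| ≤ q ∧ 2 ∣ p + |u| ∧ 2 ∣ q + |w| ∧
      ∑ i ∈ Finset.range n, a i = u + w ∧ ∑ i ∈ Finset.range n, b i = u - w ∧
      u ^ 2 - w ^ 2 + 2 * (|u| * |w|) - (p + |u|) * (q + |w|) - p + q
        ≤ 2 * ∑ i ∈ Finset.range n, a i * ∑ j ∈ Finset.range i, b j := by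
  induction n with
  | zero => exact ⟨0, 0, 0, 0, by simp⟩
  | succ n ih =>
    obtain ⟨p, q, u, w, hpq, hu, hw, hpu, hqw, hP, hR, hX⟩ := ih
    simp only [Finset.sum_range_succ, hP, hR]
    generalize ∑ i ∈ Finset.range n, a i * ∑ j ∈ Finset.range i, b j = X at hX ⊢
    have abs_step : ∀ s v : ℤ, (s = 1 ∨ s = -1) →
        (|v + s| = |v| + 1 ∨ |v + s| = |v| - 1) := by
      intro s v hs
      rcases hs with rfl | rfl <;> grind
    have hw' := abs_le.mp (le_refl |w|)
    have hu' := abs_le.mp (le_refl |u|)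
    by_cases hab : a n = b n
    · refine ⟨p + 1, q, u + a n, w, by push_cast; linarith, ?_, hw, ?_, hqw, by ring,
        by rw [← hab]; ring, ?_⟩
      · rcases abs_step _ u (ha n) with h | h <;> omega
      · rcases abs_step _ u (ha n) with h | h <;> omega
      · rcases abs_step _ u (ha n) with h | h <;> rw [h] <;>
          rcases ha n with h1 | h1 <;> rw [h1] <;> nlinarith
    · have hba : b n = -a n := by
        rcases ha n with h | h <;> rcases hb n with h' | h' <;> simp_all
      refine ⟨p, q + 1, u, w + a n, by push_cast; linarith, hu, ?_, hpu, ?_, by ring,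
        by rw [hba]; ring, ?_⟩
      · rcases abs_step _ w (ha n) with h | h <;> omega
      · rcases abs_step _ w (ha n) with h | h <;> omega
      · rcases abs_step _ w (ha n) with h | h <;> rw [h] <;>
          rcases ha n with h1 | h1 <;> rw [h1] <;> nlinarith

/-- Minimum of the quadratic form bounding the cut size from above, attained at the balanced
pattern cuts. -/
theorem balanced_energy_le {c d u w x y z : ℤ} (hu : 0 ≤ u) (hw : w ≤ d)
    (hn : x + y + z = 2 * c + 2 * d - u - w)
    (hxyz : x = y + 1 ∧ z = y ∨ x = y + 1 ∧ z = y + 1 ∨ x = y ∧ z = y) :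
    3 * (x - z) ^ 2 + y ^ 2 - 2 * (x + z) * y - (x + z) + y
      ≤ 3 * u ^ 2 + w ^ 2 + 2 * (u * w) - 4 * (c * d) - 2 * c + u + 2 * d - w := by
  have hU : 0 ≤ u * (u + 1) := by positivity
  have sq_pos : ∀ e : ℤ, e ≠ 0 → 1 ≤ e ^ 2 := fun e he => by
    have := sq_pos_of_ne_zero he
    omega
  rcases hxyz with ⟨rfl, rfl⟩ | ⟨rfl, rfl⟩ | ⟨rfl, rfl⟩
  · obtain ⟨j, hj⟩ : ∃ j, c + d - 2 * z - 1 = j := ⟨_, rfl⟩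
    obtain rfl : w = z + 1 + 2 * j - u := by omega
    obtain rfl : c = 2 * z + 1 + j - d := by omega
    have key : 4 ≤ 3 * j ^ 2 + 2 * (u * (u + 1)) + (2 * z + j - 2 * d) ^ 2 := by
      by_cases h0 : j = 0
      · subst h0
        by_cases hu0 : u = 0
        · subst hu0
          have : 2 * z + 0 - 2 * d ≤ -2 := by omega
          nlinarith
        · have : 1 ≤ u := by omega
          nlinarith [sq_nonneg (2 * z + 0 - 2 * d)]
      · by_cases h1 : j = 1 ∨ j = -1
        · have := sq_pos (2 * z + j - 2 * d) (by omega)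
          rcases h1 with rfl | rfl <;> linarith
        · have : 4 ≤ j ^ 2 := by
            rcases (by omega : j ≤ -2 ∨ 2 ≤ j) with h | h <;> nlinarith
          nlinarith [sq_nonneg (2 * z + j - 2 * d)]
    nlinarith
  · obtain ⟨j, hj⟩ : ∃ j, c + d - 2 * y - 1 = j := ⟨_, rfl⟩
    obtain rfl : w = y + 2 * j - u := by omega
    obtain rfl : c = 2 * y + 1 + j - d := by omega
    have key : 0 ≤ 3 * j ^ 2 - 4 * j + 2 * (u * (u + 1)) + (2 * y + j - 2 * d) ^ 2 := by
      by_cases h1 : j = 1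
      · have := sq_pos (2 * y + j - 2 * d) (by omega)
        subst h1
        linarith
      · have : 0 ≤ 3 * j ^ 2 - 4 * j := by
          rcases (by omega : j ≤ 0 ∨ 2 ≤ j) with h | h <;> nlinarith
        nlinarith [sq_nonneg (2 * y + j - 2 * d)]
    nlinarith
  · obtain ⟨j, hj⟩ : ∃ j, c + d - 2 * z = j := ⟨_, rfl⟩
    obtain rfl : w = z + 2 * j - u := by omega
    obtain rfl : c = 2 * z + j - d := by omega
    have key : 1 ≤ 3 * j ^ 2 - 2 * j + 2 * (u * (u + 1)) + (2 * z + j - 2 * d - 1) ^ 2 := by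
      by_cases h0 : j = 0
      · have := sq_pos (2 * z + j - 2 * d - 1) (by omega)
        subst h0
        linarith
      · have : 1 ≤ 3 * j ^ 2 - 2 * j := by
          rcases (by omega : j ≤ -1 ∨ 1 ≤ j) with h | h <;> nlinarith
        nlinarith [sq_nonneg (2 * z + j - 2 * d - 1)]
    nlinarith

/-- The sums entering the cut size of the pattern cut `S(x, y, z, 0)`. -/
theorem sums_of_pattern (x y z : ℕ) (a b : ℕ → ℤ)
    (ha : ∀ i < x + y + z, a i = if i < x then 1 else -1)
    (hb : ∀ i < x + y + z, b i = if i < x + y then 1 else -1) :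
    ∑ i ∈ Finset.range (x + y + z), a i = x - y - z ∧
    ∑ i ∈ Finset.range (x + y + z), b i = x + y - z ∧
    2 * ∑ i ∈ Finset.range (x + y + z), a i * ∑ j ∈ Finset.range i, b j =
      ((x : ℤ) - z) ^ 2 - y ^ 2 - 2 * (x + z) * y - (x + z) + y := by
  induction z with
  | succ z ih =>
    obtain ⟨hP, hR, hX⟩ := ih (fun i hi => ha i (by omega)) (fun i hi => hb i (by omega))
    rw [← add_assoc]
    simp only [Finset.sum_range_succ, mul_add, hP, hR, hX, ha (x + y + z) (by omega),
      hb (x + y + z) (by omega), if_neg (by omega : ¬ x + y + z < x),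
      if_neg (by omega : ¬ x + y + z < x + y)]
    push_cast
    refine ⟨by ring, by ring, by ring⟩
  | zero =>
    induction y with
    | succ y ih =>
      obtain ⟨hP, hR, hX⟩ := ih (fun i hi => ha i (by omega))
        (fun i hi => by rw [hb i (by omega), if_pos (by omega), if_pos (by omega)])
      simp only [add_zero] at hP hR hX
      rw [add_zero, ← add_assoc]
      simp only [Finset.sum_range_succ, mul_add, hP, hR, hX, ha (x + y) (by omega),
        hb (x + y) (by omega), if_neg (by omega : ¬ x + y < x),
        if_pos (by omega : x + y < x + (y + 1))]
      push_cast
      refine ⟨by ring, by ring, by ring⟩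
    | zero =>
      induction x with
      | succ x ih =>
        obtain ⟨hP, hR, hX⟩ := ih
          (fun i hi => by rw [ha i (by omega), if_pos (by omega), if_pos (by omega)])
          (fun i hi => by rw [hb i (by omega), if_pos (by omega), if_pos (by omega)])
        simp only [add_zero] at hP hR hX
        simp only [add_zero, Finset.sum_range_succ, mul_add, hP, hR, hX, ha x (by omega),
          hb x (by omega), if_pos (by omega : x < x + 1)]
        push_cast
        refine ⟨by ring, by ring, by ring⟩
      | zero => simp

theorem four_mul_cutSize_patternCut {k x y z : ℕ} (h : x + y + z = k + 1) :
    4 * (cutSize (CCk k) (patternCut k x y z 0) : ℤ) = 3 * (k + 1) ^ 2 - (k + 1)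
      - (3 * ((x : ℤ) - z) ^ 2 + y ^ 2 - 2 * (x + z) * y - (x + z) + y) := by
  have key := four_mul_cutSize_CCk k (patternCut k x y z 0)
    (fun i => if i < x then 1 else -1) (fun i => if i < x + y then 1 else -1)
    (fun i => by
      have := i.isLt
      have h' : ¬ x + y + z ≤ (i : ℕ) := by omega
      simp [patternCut, h'])
    (fun i => by simp [patternCut])
  obtain ⟨hP, hR, hX⟩ := sums_of_pattern x y z (fun i => if i < x then 1 else -1)
    (fun i => if i < x + y then 1 else -1) (fun _ _ => rfl) (fun _ _ => rfl)
  rw [h] at hP hR hX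
  rw [hP, hR, hX] at key
  rw [key]
  ring

theorem four_mul_cutSize_CCk_le {k : ℕ} (S : Finset (Fin (k + 1) ⊕ Fin (k + 1))) {x y z : ℤ}
    (h : x + y + z = k + 1)
    (hxyz : x = y + 1 ∧ z = y ∨ x = y + 1 ∧ z = y + 1 ∨ x = y ∧ z = y) :
    4 * (cutSize (CCk k) S : ℤ) ≤ 3 * (k + 1) ^ 2 - (k + 1)
      - (3 * (x - z) ^ 2 + y ^ 2 - 2 * (x + z) * y - (x + z) + y) := by
  classical
  let a : ℕ → ℤ := fun i => if ∃ j : Fin (k + 1), (j : ℕ) = i ∧ Sum.inl j ∈ S then 1 else -1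
  let b : ℕ → ℤ := fun i => if ∃ j : Fin (k + 1), (j : ℕ) = i ∧ Sum.inr j ∈ S then 1 else -1
  have key := four_mul_cutSize_CCk k S a b (fun i => by simp [a, Fin.val_inj])
    (fun i => by simp [b, Fin.val_inj])
  obtain ⟨p, q, u, w, hpq, hu, hw, ⟨c, hc⟩, ⟨d, hd⟩, hP, hR, hX⟩ :=
    exists_lattice_path_area_bound a b (fun i => ite_eq_or_eq _ _ _)
      (fun i => ite_eq_or_eq _ _ _) (k + 1)
  rw [hP, hR] at key
  push_cast at hpq
  have opt := balanced_energy_le (c := c) (d := d) (abs_nonneg u) (by omega : |w| ≤ d)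
    (by omega : x + y + z = _) hxyz
  rw [sq_abs, sq_abs] at opt
  rw [hc, hd] at hX
  nlinarith

/-- For every `k` there are nonnegative integers `x, y, z` with `x + y + z = k + 1`,
`|3x − k| ≤ 3`, `|3y − k| ≤ 3` and `|3z − k| ≤ 3`, such that the pattern cut `S(x,y,z,0)`
is a maximum cut of `CC_k`. -/
theorem CCk_exists_balanced_pattern_max_cut (k : ℕ) :
    ∃ x y z : ℕ, x + y + z = k + 1 ∧
      (3 * (x : ℤ) - k).natAbs ≤ 3 ∧
      (3 * (y : ℤ) - k).natAbs ≤ 3 ∧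
      (3 * (z : ℤ) - k).natAbs ≤ 3 ∧
      cutSize (CCk k) (patternCut k x y z 0) = maxCut (CCk k) := by
  obtain ⟨x, y, z, h, hxyz⟩ : ∃ x y z : ℕ, x + y + z = k + 1 ∧
      (x = y + 1 ∧ z = y ∨ x = y + 1 ∧ z = y + 1 ∨ x = y ∧ z = y) := by
    rcases (by omega : k % 3 = 0 ∨ k % 3 = 1 ∨ k % 3 = 2) with h | h | h
    · exact ⟨k / 3 + 1, k / 3, k / 3, by omega, by omega⟩
    · exact ⟨k / 3 + 1, k / 3, k / 3 + 1, by omega, by omega⟩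
    · exact ⟨k / 3 + 1, k / 3 + 1, k / 3 + 1, by omega, by omega⟩
  refine ⟨x, y, z, h, by omega, by omega, by omega, le_antisymm ?_ (Finset.sup_le fun S _ => ?_)⟩
  · exact Finset.le_sup (f := fun S => cutSize (CCk k) S)
      (Finset.mem_powerset.mpr (Finset.subset_univ _))
  · have hS := four_mul_cutSize_CCk_le S (x := x) (y := y) (z := z) (by exact_mod_cast h)
      (by exact_mod_cast hxyz)
    rw [← four_mul_cutSize_patternCut h] at hS
    omega
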